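/- arXiv:2605.21853 — 2 statements merged into one kernel-verified Lean document; each statement's English description precedes it below -/
import Mathlib

section
/- Let 𝒲_{e0} := {w ∈ (0,∞)^E : w_{e0}=1} and define H : 𝒲_{e0} → (0,∞)^E by H(w)_{{i,j}} := 2·w_{ij}/√(w_i·w_j) for {i,j} ∈ E, where w_i := Σ_{e∋i} w_e. Then: (i) H is injective; (ii) for every w ∈ 𝒲_{e0}, the symmetric V×V matrix B̃ with entries B̃_{ij} = H(w)_{{i,j}} when {i,j} ∈ E and 0 otherwise has spectral radius 2, and the strictly positive vector u with u_i = √(w_i) satisfies B̃u = 2u; (iii) conversely, if β̃ ∈ (0,∞)^E is such that the associated symmetric matrix B̃ (with B̃_{ij} = β̃_{{i,j}} for {i,j} ∈ E and 0 otherwise) has spectral radius 2, and u > 0 satisfies B̃u = 2u and is normalized so that (1/2)·β̃_{e0}·u_{i0}·u_{j0} = 1 where e0 = {i0, j0}, then w defined by w_{{i,j}} := (1/2)·β̃_{{i,j}}·u_i·u_j lies in 𝒲_{e0} and H(w) = β̃. -/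
open MeasureTheory Real Filter
open scoped ENNReal NNReal Classical BigOperators

noncomputable section

namespace ERRW

variable {V : Type*} [Fintype V] [DecidableEq V]

/-- Total weight at a vertex: sum of the edge weights over the edges incident to `i`. -/
def vw (G : SimpleGraph V) [DecidableRel G.Adj] (w : Sym2 V → ℝ) (i : V) : ℝ :=
  ∑ j ∈ G.neighborFinset i, w s(i, j)

/-- Product of a vertex function over the two endpoints of an unordered pair. -/
def sprod (f : V → ℝ) : Sym2 V → ℝ :=
  Sym2.lift ⟨fun i j => f i * f j, fun i j => mul_comm _ _⟩

/-- Sum of a vertex function over the two endpoints of an unordered pair. -/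
def ssum (f : V → ℝ) : Sym2 V → ℝ :=
  Sym2.lift ⟨fun i j => f i + f j, fun i j => add_comm _ _⟩

/-- Quenched transition probability `p_{ij}(w) = w_{ij}/w_i`. -/
def qstep (G : SimpleGraph V) [DecidableRel G.Adj] (w : Sym2 V → ℝ) (i j : V) : ℝ :=
  if G.Adj i j then w s(i, j) / vw G w i else 0

/-- Stationary distribution `π_i(w) = w_i / Σ_v w_v` of the quenched chain. -/
def statDist (G : SimpleGraph V) [DecidableRel G.Adj] (w : Sym2 V → ℝ) (i : V) : ℝ :=
  vw G w i / ∑ v : V, vw G w v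

/-- Spanning trees of `G`, as edge sets. -/
def spanningTrees (G : SimpleGraph V) [DecidableRel G.Adj] : Finset (Finset (Sym2 V)) :=
  G.edgeFinset.powerset.filter fun F =>
    (SimpleGraph.fromEdgeSet (F : Set (Sym2 V))).IsTree

/-- Spanning-tree polynomial `τ(w) = Σ_{T} Π_{e ∈ T} w_e`. -/
def tau (G : SimpleGraph V) [DecidableRel G.Adj] (w : Sym2 V → ℝ) : ℝ :=
  ∑ F ∈ spanningTrees G, ∏ e ∈ F, w e

/-- Vertex parameter `b_v = (B_v + 1 - 𝟙(v = x))/2`. -/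
def bwt (G : SimpleGraph V) [DecidableRel G.Adj] (x : V) (B : Sym2 V → ℝ) (v : V) : ℝ :=
  (vw G B v + 1 - if v = x then 1 else 0) / 2

/-- The normalizing constant `Z_{x,B}` of the magic formula. -/
def Znorm (G : SimpleGraph V) [DecidableRel G.Adj] (x : V) (B : Sym2 V → ℝ) : ℝ :=
  ((∏ e ∈ G.edgeFinset, Real.Gamma (B e)) /
      ∏ v : V, Real.Gamma (bwt G x B v)) *
    Real.pi ^ (((Fintype.card V : ℝ) - 1) / 2) /
    2 ^ ((1 : ℝ) - (Fintype.card V : ℝ) + ∑ e ∈ G.edgeFinset, B e)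

/-- The magic-formula density of `μ_{x,B}` with respect to `Π_{e ≠ e0} dw_e`. -/
def magicDensity (G : SimpleGraph V) [DecidableRel G.Adj] (x : V) (B : Sym2 V → ℝ)
    (w : Sym2 V → ℝ) : ℝ :=
  (Znorm G x B)⁻¹ * (vw G w x) ^ ((1 : ℝ) / 2) *
      (∏ e ∈ G.edgeFinset, w e ^ (B e - 1)) /
      (∏ v : V, (vw G w v) ^ ((vw G B v + 1) / 2)) *
    Real.sqrt (tau G w)

/-- Coordinates indexed by the non-reference edges. -/
abbrev Epin (G : SimpleGraph V) [DecidableRel G.Adj] (e0 : Sym2 V) :=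
  {e : Sym2 V // e ∈ G.edgeFinset ∧ e ≠ e0}

/-- Extension of non-reference edge coordinates to a pinned environment (`w_{e0} = 1`). -/
def pinExt (G : SimpleGraph V) [DecidableRel G.Adj] (e0 : Sym2 V)
    (u : Epin G e0 → ℝ) : Sym2 V → ℝ :=
  fun e => if e = e0 then 1 else if h : e ∈ G.edgeFinset ∧ e ≠ e0 then u ⟨e, h⟩ else 0

/-- The mixing measure `μ_{x,B}` of the magic formula, as a measure on
environments pinned at the reference edge `e0`. -/
def mixing (G : SimpleGraph V) [DecidableRel G.Adj] (e0 : Sym2 V) (x : V) (B : Sym2 V → ℝ) :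
    Measure (Sym2 V → ℝ) :=
  Measure.map (pinExt G e0)
    ((volume : Measure (Epin G e0 → ℝ)).withDensity fun u =>
      ENNReal.ofReal
        (if ∀ e ∈ G.edgeFinset, 0 < pinExt G e0 u e then
          magicDensity G x B (pinExt G e0 u) else 0))

/-- Kullback–Leibler divergence (natural logarithm), `+∞` if `P` is not
absolutely continuous with respect to `Q`. -/
def KL {Ω : Type*} [MeasurableSpace Ω] (P Q : Measure Ω) : EReal :=
  if P ≪ Q then ((∫ x, Real.log (P.rnDeriv Q x).toReal ∂P : ℝ) : EReal) else ⊤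

/-- Edge local time (current edge weight) at time `t` along a path. -/
def localTime (a : Sym2 V → ℝ) (x : ℕ → V) (t : ℕ) (e : Sym2 V) : ℝ :=
  a e + ((Finset.range t).filter fun k => s(x k, x (k + 1)) = e).card

/-- One-step ERRW conditional probability at time `t` given the past of the path. -/
def errwStep (G : SimpleGraph V) [DecidableRel G.Adj] (a : Sym2 V → ℝ) (x : ℕ → V)
    (t : ℕ) : ℝ :=
  if G.Adj (x t) (x (t + 1)) then
    localTime a x t s(x t, x (t + 1)) /
      ∑ u ∈ G.neighborFinset (x t), localTime a x t s(x t, u)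
  else 0

/-- Extension of a finite path to ℕ (junk value `v0` beyond time `T`). -/
def extendPath {T : ℕ} (v0 : V) (x : Fin (T + 1) → V) : ℕ → V :=
  fun t => if h : t < T + 1 then x ⟨t, h⟩ else v0

/-- ERRW trajectory probability of a length-`T` path (the trajectory law mass function). -/
def errwProb (G : SimpleGraph V) [DecidableRel G.Adj] (v0 : V) (a : Sym2 V → ℝ) (T : ℕ)
    (x : Fin (T + 1) → V) : ℝ :=
  if x 0 = v0 then ∏ t ∈ Finset.range T, errwStep G a (extendPath v0 x) t else 0

/-- Undirected traversal count `N_e` of an edge along a finite path. -/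
def edgeCount {T : ℕ} (v0 : V) (x : Fin (T + 1) → V) (e : Sym2 V) : ℕ :=
  ((Finset.range T).filter fun k =>
    s(extendPath v0 x k, extendPath v0 x (k + 1)) = e).card

/-- Quenched path probability of a length-`T` path started at `v0`. -/
def quenchedProb (G : SimpleGraph V) [DecidableRel G.Adj] (v0 : V) (w : Sym2 V → ℝ) (T : ℕ)
    (x : Fin (T + 1) → V) : ℝ :=
  if x 0 = v0 then
    ∏ t ∈ Finset.range T, qstep G w (extendPath v0 x t) (extendPath v0 x (t + 1))
  else 0

/-- The measure on a finite type determined by a mass function. -/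
def discreteMeasure {Ω : Type*} [Fintype Ω] [MeasurableSpace Ω] (p : Ω → ℝ) : Measure Ω :=
  ∑ x : Ω, ENNReal.ofReal (p x) • Measure.dirac x

/-- Digamma function `Ψ = (log Γ)'`. -/
def digamma (x : ℝ) : ℝ := deriv (fun y => Real.log (Real.Gamma y)) x

/-- Trigamma function `Ψ₁ = Ψ'`. -/
def trigamma (x : ℝ) : ℝ := deriv digamma x

/-- `Λ(p,q) = log Γ(q) − log Γ(p) − (q−p)·Ψ(p)`. -/
def Lam (p q : ℝ) : ℝ :=
  Real.log (Real.Gamma q) - Real.log (Real.Gamma p) - (q - p) * digamma p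

/-- `H(w)_{{i,j}} = 2 w_{ij} / √(w_i w_j)` : the normalized field map on pinned environments. -/
def Hmap {V : Type*} [Fintype V] [DecidableEq V]
    (G : SimpleGraph V) [DecidableRel G.Adj] (w : Sym2 V → ℝ) : Sym2 V → ℝ :=
  fun e => 2 * w e / Real.sqrt (sprod (vw G w) e)

/-- The symmetric `V × V` matrix with entries `β_{{i,j}}` on adjacent pairs and `0` otherwise. -/
def matOf {V : Type*} [Fintype V] [DecidableEq V]
    (G : SimpleGraph V) [DecidableRel G.Adj] (β : Sym2 V → ℝ) : Matrix V V ℝ :=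
  fun i j => if G.Adj i j then β s(i, j) else 0

/-- The spectral radius of a real square matrix: the maximum modulus of its complex
eigenvalues. -/
def specRad {V : Type*} [Fintype V] [DecidableEq V] (M : Matrix V V ℝ) : ℝ≥0∞ :=
  spectralRadius ℂ (M.map fun t : ℝ => (t : ℂ))

theorem matOf_mulVec (G : SimpleGraph V) [DecidableRel G.Adj] (β : Sym2 V → ℝ) (u : V → ℝ)
    (i : V) : (matOf G β).mulVec u i = ∑ j ∈ G.neighborFinset i, β s(i, j) * u j := by
  simp only [Matrix.mulVec, dotProduct, matOf, ite_mul, zero_mul]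
  rw [← Finset.sum_filter]
  congr 1
  ext j
  simp

omit [DecidableEq V] in
theorem vw_pos {G : SimpleGraph V} [DecidableRel G.Adj] [Nontrivial V] (hG : G.Connected)
    {w : Sym2 V → ℝ} (hw : ∀ e ∈ G.edgeFinset, 0 < w e) (i : V) : 0 < vw G w i := by
  obtain ⟨j, hj⟩ := hG.preconnected.exists_adj_of_nontrivial i
  refine Finset.sum_pos (fun k hk => hw _ ?_) ⟨j, by simpa using hj⟩
  simpa using hk

theorem Hmap_mk (G : SimpleGraph V) [DecidableRel G.Adj] (w : Sym2 V → ℝ) {i : V}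
    (hi : 0 ≤ vw G w i) (j : V) :
    Hmap G w s(i, j) = 2 * w s(i, j) / (√(vw G w i) * √(vw G w j)) := by
  simp [Hmap, sprod, Real.sqrt_mul hi]

theorem Hmap_mulVec_sqrt (G : SimpleGraph V) [DecidableRel G.Adj] (w : Sym2 V → ℝ)
    (hw : ∀ i, 0 < vw G w i) :
    (matOf G (Hmap G w)).mulVec (fun i => √(vw G w i)) = (2 : ℝ) • fun i => √(vw G w i) := by
  funext i
  have hterm : ∀ j, Hmap G w s(i, j) * √(vw G w j) = 2 * w s(i, j) / √(vw G w i) := by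
    intro j
    have hi := (Real.sqrt_pos.2 (hw i)).ne'
    have hj := (Real.sqrt_pos.2 (hw j)).ne'
    rw [Hmap_mk G w (hw i).le]
    field_simp
  rw [matOf_mulVec, Finset.sum_congr rfl fun j _ => hterm j, ← Finset.sum_div, ← Finset.mul_sum,
    mul_div_assoc]
  change 2 * (vw G w i / √(vw G w i)) = 2 * √(vw G w i)
  rw [Real.div_sqrt]

theorem Hmap_pos {G : SimpleGraph V} [DecidableRel G.Adj] {w : Sym2 V → ℝ}
    (hw : ∀ e ∈ G.edgeFinset, 0 < w e) (hv : ∀ i, 0 < vw G w i) :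
    ∀ e ∈ G.edgeFinset, 0 < Hmap G w e := by
  intro e
  induction e with | _ i j
  intro he
  rw [Hmap_mk G w (hv i).le]
  have h := hw _ he
  have hi := Real.sqrt_pos.2 (hv i)
  have hj := Real.sqrt_pos.2 (hv j)
  positivity

omit [DecidableEq V] in
/-- The eigenvalue of a positive eigenvector of a nonnegative symmetric matrix bounds the modulus
of every complex eigenvalue. -/
theorem norm_eigenvalue_le {M : Matrix V V ℝ} (hM : ∀ i j, 0 ≤ M i j) (hsymm : M.IsSymm)
    {u : V → ℝ} (hu : ∀ i, 0 < u i) {r : ℝ} (hMu : M.mulVec u = r • u) {k : ℂ} {v : V → ℂ}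
    (hv : v ≠ 0) (hkv : (M.map fun t : ℝ => (t : ℂ)).mulVec v = k • v) : ‖k‖ ≤ r := by
  have hbound : ∀ i, ‖k‖ * ‖v i‖ ≤ ∑ j, M i j * ‖v j‖ := by
    intro i
    have h : ∑ j, (M i j : ℂ) * v j = k * v i := congrFun hkv i
    rw [← norm_mul, ← h]
    refine (norm_sum_le _ _).trans_eq (Finset.sum_congr rfl fun j _ => ?_)
    rw [norm_mul, Complex.norm_real, Real.norm_of_nonneg (hM i j)]
  have hcol : ∀ j, ∑ i, u i * M i j = r * u j := by
    intro j
    have h : ∑ i, M j i * u i = r * u j := congrFun hMu j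
    rw [← h]
    exact Finset.sum_congr rfl fun i _ => by rw [hsymm.apply i j |>.symm, mul_comm]
  have hpos : 0 < ∑ i, u i * ‖v i‖ := by
    obtain ⟨i, hi⟩ := Function.ne_iff.1 hv
    exact Finset.sum_pos' (fun j _ => mul_nonneg (hu j).le (norm_nonneg _))
      ⟨i, Finset.mem_univ i, mul_pos (hu i) (norm_pos_iff.2 hi)⟩
  refine le_of_mul_le_mul_right ?_ hpos
  calc ‖k‖ * ∑ i, u i * ‖v i‖ = ∑ i, u i * (‖k‖ * ‖v i‖) := by
        rw [Finset.mul_sum]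
        exact Finset.sum_congr rfl fun i _ => by ring
    _ ≤ ∑ i, u i * ∑ j, M i j * ‖v j‖ :=
        Finset.sum_le_sum fun i _ => mul_le_mul_of_nonneg_left (hbound i) (hu i).le
    _ = ∑ j, (∑ i, u i * M i j) * ‖v j‖ := by
        simp only [Finset.mul_sum, Finset.sum_mul, mul_assoc]
        exact Finset.sum_comm
    _ = r * ∑ i, u i * ‖v i‖ := by
        simp only [hcol, Finset.mul_sum, mul_assoc]

theorem mem_spectrum_iff_exists_mulVec (A : Matrix V V ℂ) (k : ℂ) :
    k ∈ spectrum ℂ A ↔ ∃ v : V → ℂ, v ≠ 0 ∧ A.mulVec v = k • v := by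
  rw [← Matrix.spectrum_toLin', ← Module.End.hasEigenvalue_iff_mem_spectrum]
  constructor
  · intro h
    obtain ⟨v, hv⟩ := h.exists_hasEigenvector
    exact ⟨v, hv.2, by simpa using hv.apply_eq_smul⟩
  · rintro ⟨v, hv, h⟩
    exact Module.End.hasEigenvalue_of_hasEigenvector (x := v)
      ⟨Module.End.mem_eigenspace_iff.2 (by simpa using h), hv⟩

/-- A positive eigenvector of a nonnegative symmetric matrix has its spectral radius as eigenvalue. -/
theorem specRad_eq_of_pos_eigenvector [Nonempty V] {M : Matrix V V ℝ} (hM : ∀ i j, 0 ≤ M i j)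
    (hsymm : M.IsSymm) {u : V → ℝ} (hu : ∀ i, 0 < u i) {r : ℝ≥0}
    (hMu : M.mulVec u = (r : ℝ) • u) : specRad M = r := by
  refine le_antisymm (iSup₂_le fun k hk => ?_) ?_
  · obtain ⟨v, hv, h⟩ := (mem_spectrum_iff_exists_mulVec _ k).1 hk
    exact ENNReal.coe_le_coe.2 (norm_eigenvalue_le hM hsymm hu hMu hv h)
  · have hmem : ((r : ℝ) : ℂ) ∈ spectrum ℂ (M.map fun t : ℝ => (t : ℂ)) := by
      refine (mem_spectrum_iff_exists_mulVec _ _).2 ⟨fun i => (u i : ℂ), fun h => ?_, ?_⟩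
      · obtain ⟨i⟩ := ‹Nonempty V›
        exact (hu i).ne' (by simpa using congrFun h i)
      · funext i
        have h : ∑ j, M i j * u j = r * u i := congrFun hMu i
        change ∑ j, (M i j : ℂ) * (u j : ℂ) = ((r : ℝ) : ℂ) * (u i : ℂ)
        exact_mod_cast h
    have hnorm : ‖((r : ℝ) : ℂ)‖₊ = r := by
      ext
      simp
    refine le_trans ?_ (le_iSup₂ (f := fun k (_ : k ∈ spectrum ℂ _) => (‖k‖₊ : ℝ≥0∞)) _ hmem)
    rw [hnorm]

theorem matOf_isSymm (G : SimpleGraph V) [DecidableRel G.Adj] (β : Sym2 V → ℝ) :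
    (matOf G β).IsSymm := by
  ext i j
  simp [matOf, Matrix.transpose_apply, G.adj_comm i j, Sym2.eq_swap (a := i) (b := j)]

theorem matOf_nonneg {G : SimpleGraph V} [DecidableRel G.Adj] {β : Sym2 V → ℝ}
    (hβ : ∀ e ∈ G.edgeFinset, 0 < β e) (i j : V) : 0 ≤ matOf G β i j := by
  unfold matOf
  split_ifs with h
  · exact (hβ _ (by simpa using h)).le
  · exact le_rfl

/-- Positive eigenvectors of a weighted connected graph with the same eigenvalue are
proportional. -/
theorem exists_eq_mul_of_pos_eigenvector {G : SimpleGraph V} [DecidableRel G.Adj]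
    (hG : G.Connected) {β : Sym2 V → ℝ} (hβ : ∀ e ∈ G.edgeFinset, 0 < β e) {r : ℝ}
    {u u' : V → ℝ} (hu' : ∀ i, 0 < u' i) (hMu : (matOf G β).mulVec u = r • u)
    (hMu' : (matOf G β).mulVec u' = r • u') : ∃ c : ℝ, ∀ i, u i = c * u' i := by
  have := hG.nonempty
  obtain ⟨m, hm⟩ := Finite.exists_min fun i => u i / u' i
  set c := u m / u' m with hc
  have hle : ∀ i, 0 ≤ u i - c * u' i := fun i =>
    sub_nonneg.2 ((le_div_iff₀ (hu' i)).1 (hm i))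
  have hsum : ∀ i, ∑ j ∈ G.neighborFinset i, β s(i, j) * (u j - c * u' j)
      = r * (u i - c * u' i) := by
    intro i
    have h := congrFun hMu i
    have h' := congrFun hMu' i
    rw [matOf_mulVec, Pi.smul_apply, smul_eq_mul] at h h'
    calc ∑ j ∈ G.neighborFinset i, β s(i, j) * (u j - c * u' j)
        = ∑ j ∈ G.neighborFinset i, β s(i, j) * u j
          - c * ∑ j ∈ G.neighborFinset i, β s(i, j) * u' j := by
          rw [Finset.mul_sum, ← Finset.sum_sub_distrib]
          exact Finset.sum_congr rfl fun j _ => by ring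
      _ = r * (u i - c * u' i) := by rw [h, h']; ring
  have hstep : ∀ i j, G.Adj i j → u i - c * u' i = 0 → u j - c * u' j = 0 := by
    intro i j hij hi
    have hβ' : ∀ k ∈ G.neighborFinset i, 0 < β s(i, k) := fun k hk =>
      hβ _ (by simpa using hk)
    have hz := hsum i
    rw [hi, mul_zero, Finset.sum_eq_zero_iff_of_nonneg
      fun k hk => mul_nonneg (hβ' k hk).le (hle k)] at hz
    have hj : j ∈ G.neighborFinset i := by simpa using hij
    exact (mul_eq_zero.1 (hz j hj)).resolve_left (hβ' j hj).ne'
  have hwalk : ∀ {i j : V}, G.Walk i j → u i - c * u' i = 0 → u j - c * u' j = 0 := by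
    intro i j p
    induction p with
    | nil => exact id
    | cons h _ ih => exact fun hi => ih (hstep _ _ h hi)
  refine ⟨c, fun i => sub_eq_zero.1 ?_⟩
  obtain ⟨p⟩ := hG.preconnected m i
  exact hwalk p (by rw [hc, div_mul_cancel₀ _ (hu' m).ne', sub_self])

theorem eq_Hmap_mul (G : SimpleGraph V) [DecidableRel G.Adj] {w : Sym2 V → ℝ}
    (hw : ∀ i, 0 < vw G w i) (i j : V) :
    w s(i, j) = 1 / 2 * Hmap G w s(i, j) * (√(vw G w i) * √(vw G w j)) := by
  have hi := (Real.sqrt_pos.2 (hw i)).ne'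
  have hj := (Real.sqrt_pos.2 (hw j)).ne'
  rw [Hmap_mk G w (hw i).le]
  field_simp

theorem matOf_congr {G : SimpleGraph V} [DecidableRel G.Adj] {β β' : Sym2 V → ℝ}
    (h : ∀ e ∈ G.edgeFinset, β e = β' e) : matOf G β = matOf G β' := by
  funext i j
  unfold matOf
  split_ifs with hij
  · exact h _ (by simpa using hij)
  · rfl

theorem Hmap_injOn_pinned {G : SimpleGraph V} [DecidableRel G.Adj] [Nontrivial V]
    (hG : G.Connected) {e0 : Sym2 V} (he0 : e0 ∈ G.edgeFinset) {w w' : Sym2 V → ℝ}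
    (h0 : w e0 = 1) (h0' : w' e0 = 1) (hw : ∀ e ∈ G.edgeFinset, 0 < w e)
    (hw' : ∀ e ∈ G.edgeFinset, 0 < w' e) (hH : ∀ e ∈ G.edgeFinset, Hmap G w e = Hmap G w' e) :
    ∀ e ∈ G.edgeFinset, w e = w' e := by
  have hv := vw_pos hG hw
  have hv' := vw_pos hG hw'
  have hM := Hmap_mulVec_sqrt G w hv
  rw [matOf_congr hH] at hM
  obtain ⟨c, hc⟩ := exists_eq_mul_of_pos_eigenvector hG (Hmap_pos hw' hv')
    (fun i => Real.sqrt_pos.2 (hv' i)) hM (Hmap_mulVec_sqrt G w' hv')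
  have hscale : ∀ e ∈ G.edgeFinset, w e = c ^ 2 * w' e := by
    intro e
    induction e with | _ i j
    intro he
    rw [eq_Hmap_mul G hv, eq_Hmap_mul G hv', hH _ he, hc i, hc j]
    ring
  have hc2 : c ^ 2 = 1 := by
    have h := hscale e0 he0
    rw [h0, h0', mul_one] at h
    exact h.symm
  intro e he
  rw [hscale e he, hc2, one_mul]

theorem vw_of_eigenvector (G : SimpleGraph V) [DecidableRel G.Adj] (β : Sym2 V → ℝ) (u : V → ℝ)
    (hMu : (matOf G β).mulVec u = (2 : ℝ) • u) (i : V) :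
    vw G (fun e => 1 / 2 * β e * sprod u e) i = u i ^ 2 := by
  have h := congrFun hMu i
  rw [matOf_mulVec, Pi.smul_apply, smul_eq_mul] at h
  calc vw G (fun e => 1 / 2 * β e * sprod u e) i
      = 1 / 2 * u i * ∑ j ∈ G.neighborFinset i, β s(i, j) * u j := by
        rw [vw, Finset.mul_sum]
        refine Finset.sum_congr rfl fun j _ => ?_
        simp only [sprod, Sym2.lift_mk]
        ring
    _ = u i ^ 2 := by rw [h]; ring

theorem Hmap_of_eigenvector (G : SimpleGraph V) [DecidableRel G.Adj] (β : Sym2 V → ℝ)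
    {u : V → ℝ} (hu : ∀ i, 0 < u i) (hMu : (matOf G β).mulVec u = (2 : ℝ) • u) (e : Sym2 V) :
    Hmap G (fun e' => 1 / 2 * β e' * sprod u e') e = β e := by
  induction e with | _ i j
  have hv := vw_of_eigenvector G β u hMu
  have hi := (hu i).ne'
  have hj := (hu j).ne'
  rw [Hmap_mk _ _ (by rw [hv]; positivity), hv, hv, Real.sqrt_sq (hu i).le,
    Real.sqrt_sq (hu j).le]
  simp only [sprod, Sym2.lift_mk]
  field_simp

omit [Fintype V] [DecidableEq V] in
theorem sprod_pos {u : V → ℝ} (hu : ∀ i, 0 < u i) (e : Sym2 V) : 0 < sprod u e := by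
  induction e with | _ i j
  exact mul_pos (hu i) (hu j)

/-- Pinned environments and normalized fields:
(i) `H` is injective on the pinned environments;
(ii) for a pinned environment `w`, the associated matrix `B̃` has spectral radius `2` and the
strictly positive vector `u_i = √(w_i)` satisfies `B̃ u = 2 u`;
(iii) conversely, if the matrix of `β̃ ∈ (0,∞)^E` has spectral radius `2`, `u > 0` satisfies
`B̃ u = 2 u` with the normalization `(1/2) β̃_{e0} u_{i0} u_{j0} = 1` at `e0 = {i0,j0}`, then
`w_{{i,j}} := (1/2) β̃_{{i,j}} u_i u_j` is a pinned environment with `H(w) = β̃`. -/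
theorem normalized_field_bijection
    {V : Type*} [Fintype V] [DecidableEq V]
    (G : SimpleGraph V) [DecidableRel G.Adj] (hG : G.Connected)
    (e0 : Sym2 V) (he0 : e0 ∈ G.edgeFinset) :
    -- (i) injectivity of H on pinned environments
    (∀ w w' : Sym2 V → ℝ, w e0 = 1 → w' e0 = 1 →
      (∀ e ∈ G.edgeFinset, 0 < w e) → (∀ e ∈ G.edgeFinset, 0 < w' e) →
      (∀ e ∈ G.edgeFinset, Hmap G w e = Hmap G w' e) →
      ∀ e ∈ G.edgeFinset, w e = w' e) ∧
    -- (ii) spectral radius 2 and positive eigenvector u_i = √(w_i)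
    (∀ w : Sym2 V → ℝ, w e0 = 1 → (∀ e ∈ G.edgeFinset, 0 < w e) →
      specRad (matOf G (Hmap G w)) = 2 ∧
      (∀ i : V, 0 < Real.sqrt (vw G w i)) ∧
      (matOf G (Hmap G w)).mulVec (fun i => Real.sqrt (vw G w i))
        = (2 : ℝ) • fun i => Real.sqrt (vw G w i)) ∧
    -- (iii) reconstruction of the pinned environment from the normalized field
    (∀ β : Sym2 V → ℝ, (∀ e ∈ G.edgeFinset, 0 < β e) →
      specRad (matOf G β) = 2 →
      ∀ u : V → ℝ, (∀ i : V, 0 < u i) → (matOf G β).mulVec u = (2 : ℝ) • u →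
      ∀ i0 j0 : V, e0 = s(i0, j0) → 1 / 2 * β e0 * u i0 * u j0 = 1 →
      (fun e => 1 / 2 * β e * sprod u e) e0 = 1 ∧
      (∀ e ∈ G.edgeFinset, 0 < 1 / 2 * β e * sprod u e) ∧
      (∀ e ∈ G.edgeFinset, Hmap G (fun e' => 1 / 2 * β e' * sprod u e') e = β e)) := by
  have : Nontrivial V := by
    induction e0 with | _ i j
    exact ⟨i, j, (show G.Adj i j by simpa using he0).ne⟩
  refine ⟨fun w w' h0 h0' hw hw' hH => Hmap_injOn_pinned hG he0 h0 h0' hw hw' hH, ?_, ?_⟩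
  · intro w _ hw
    have hv := vw_pos hG hw
    have hpos : ∀ i, 0 < √(vw G w i) := fun i => Real.sqrt_pos.2 (hv i)
    have hM := Hmap_mulVec_sqrt G w hv
    exact ⟨specRad_eq_of_pos_eigenvector (r := 2) (matOf_nonneg (Hmap_pos hw hv))
      (matOf_isSymm G _) hpos hM, hpos, hM⟩
  · rintro β hβ - u hu hMu i0 j0 rfl hnorm
    refine ⟨?_, fun e he => ?_, fun e _ => Hmap_of_eigenvector G β hu hMu e⟩
    · simpa only [sprod, Sym2.lift_mk, mul_assoc] using hnorm
    · exact mul_pos (mul_pos one_half_pos (hβ e he)) (sprod_pos hu e)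

end ERRW
end
end

section
/- Let x_0, …, x_T be a path in G with x_0 = v0 and T ≥ 1 (i.e. {x_{t−1}, x_t} ∈ E for all 1 ≤ t ≤ T), let N := (N_e(x_0^T))_{e∈E} be its undirected edge-count vector, and let x_T be its endpoint. Then the ERRW trajectory probability equals a ratio of magic-formula normalizing constants: P_errw^{v0,A}(X_0^T = x_0^T) = Z_{x_T, A+N} / Z_{v0, A}. -/
open MeasureTheory Real Filter
open scoped ENNReal NNReal Classical BigOperators

noncomputable section

namespace ERRW

variable {V : Type*} [Fintype V] [DecidableEq V]

/-- Adding one to the weight of the edge `{x, y}` raises the vertex weight by one at both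
endpoints and leaves the others unchanged. -/
theorem vw_add_indicator (G : SimpleGraph V) [DecidableRel G.Adj] {x y : V} (h : G.Adj x y)
    (B : Sym2 V → ℝ) (v : V) :
    vw G (fun e => B e + if s(x, y) = e then 1 else 0) v
      = vw G B v + ((if v = x then 1 else 0) + if v = y then 1 else 0) := by
  have hne : x ≠ y := h.ne
  unfold vw
  rw [Finset.sum_add_distrib]
  congr 1
  by_cases hx : v = x
  · subst hx
    rw [Finset.sum_eq_single y]
    · simp [hne]
    · intro b _ hb
      simp [hb.symm, hne.symm]
    · intro hy
      simp [h] at hy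
  · by_cases hy : v = y
    · subst hy
      rw [Finset.sum_eq_single x]
      · simp [hne.symm, Sym2.eq_swap]
      · intro b _ hb
        simp [hne, hb.symm]
      · intro hx'
        simp [h.symm] at hx'
    · simp only [hx, hy, if_false, add_zero]
      apply Finset.sum_eq_zero
      intro b _
      simp [Ne.symm hx, Ne.symm hy]

omit [DecidableEq V] in
theorem vw_nonneg (G : SimpleGraph V) [DecidableRel G.Adj] {B : Sym2 V → ℝ}
    (hB : ∀ e ∈ G.edgeFinset, 0 < B e) (v : V) : 0 ≤ vw G B v :=
  Finset.sum_nonneg fun j hj => (hB _ (by simpa using hj)).le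

omit [DecidableEq V] in
theorem vw_pos_s7 (G : SimpleGraph V) [DecidableRel G.Adj] {B : Sym2 V → ℝ}
    (hB : ∀ e ∈ G.edgeFinset, 0 < B e) {x y : V} (h : G.Adj x y) : 0 < vw G B x :=
  Finset.sum_pos (fun j hj => hB _ (by simpa using hj)) ⟨y, by simpa using h⟩

/-- Product of Gamma factors over edges after incrementing the weight of one edge. -/
theorem prod_Gamma_add_indicator (G : SimpleGraph V) [DecidableRel G.Adj] {x y : V}
    (h : G.Adj x y) {B : Sym2 V → ℝ} (hB : ∀ e ∈ G.edgeFinset, 0 < B e) :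
    ∏ e ∈ G.edgeFinset, Real.Gamma (B e + if s(x, y) = e then 1 else 0)
      = B s(x, y) * ∏ e ∈ G.edgeFinset, Real.Gamma (B e) := by
  have hmem : s(x, y) ∈ G.edgeFinset := by simpa using h
  have key : ∀ e ∈ G.edgeFinset, Real.Gamma (B e + if s(x, y) = e then 1 else 0)
      = (if s(x, y) = e then B e else 1) * Real.Gamma (B e) := by
    intro e he
    split_ifs
    · exact Real.Gamma_add_one (hB e he).ne'
    · simp
  rw [Finset.prod_congr rfl key, Finset.prod_mul_distrib, Finset.prod_ite_eq, if_pos hmem]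

/-- Product of Gamma factors over vertices when the weight of `{x, y}` is incremented and the
root moves from `x` to `y`. -/
theorem prod_Gamma_bwt_add_indicator (G : SimpleGraph V) [DecidableRel G.Adj] {x y : V}
    (h : G.Adj x y) {B : Sym2 V → ℝ} (hB : ∀ e ∈ G.edgeFinset, 0 < B e) :
    ∏ v, Real.Gamma (bwt G y (fun e => B e + if s(x, y) = e then 1 else 0) v)
      = vw G B x / 2 * ∏ v, Real.Gamma (bwt G x B v) := by
  have hpos := vw_pos_s7 G hB h
  have key : ∀ v ∈ Finset.univ,
      Real.Gamma (bwt G y (fun e => B e + if s(x, y) = e then 1 else 0) v)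
      = (if x = v then vw G B v / 2 else 1) * Real.Gamma (bwt G x B v) := by
    intro v _
    unfold bwt
    rw [vw_add_indicator G h]
    by_cases hv : v = x
    · subst hv
      have hz : (vw G B v + 1 - 1) / 2 = vw G B v / 2 := by ring
      simp only [if_true, if_neg h.ne]
      rw [hz, ← Real.Gamma_add_one (by positivity)]
      congr 1
      ring
    · rw [if_neg hv, if_neg (Ne.symm hv), one_mul]
      congr 1
      ring
  rw [Finset.prod_congr rfl key, Finset.prod_mul_distrib, Finset.prod_ite_eq,
    if_pos (Finset.mem_univ x)]

theorem Znorm_pos (G : SimpleGraph V) [DecidableRel G.Adj] {x y : V} (h : G.Adj x y)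
    {B : Sym2 V → ℝ} (hB : ∀ e ∈ G.edgeFinset, 0 < B e) : 0 < Znorm G x B := by
  have hE : 0 < ∏ e ∈ G.edgeFinset, Real.Gamma (B e) :=
    Finset.prod_pos fun e he => Real.Gamma_pos_of_pos (hB e he)
  have hV : 0 < ∏ v, Real.Gamma (bwt G x B v) := by
    refine Finset.prod_pos fun v _ => Real.Gamma_pos_of_pos ?_
    unfold bwt
    split_ifs with hv
    · subst hv
      linarith [vw_pos_s7 G hB h]
    · linarith [vw_nonneg G hB v]
  unfold Znorm
  positivity

/-- One-step recursion of the magic-formula normalizing constant. -/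
theorem Znorm_add_indicator (G : SimpleGraph V) [DecidableRel G.Adj] {x y : V} (h : G.Adj x y)
    {B : Sym2 V → ℝ} (hB : ∀ e ∈ G.edgeFinset, 0 < B e) :
    Znorm G y (fun e => B e + if s(x, y) = e then 1 else 0)
      = Znorm G x B * (B s(x, y) / vw G B x) := by
  have hpos := (vw_pos_s7 G hB h).ne'
  have hmem : s(x, y) ∈ G.edgeFinset := by simpa using h
  unfold Znorm
  rw [prod_Gamma_add_indicator G h hB, prod_Gamma_bwt_add_indicator G h hB,
    Finset.sum_add_distrib, Finset.sum_ite_eq, if_pos hmem, ← add_assoc,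
    Real.rpow_add_one two_ne_zero]
  simp only [div_eq_mul_inv, mul_inv, inv_inv]
  ring

omit [Fintype V] in
theorem localTime_succ (a : Sym2 V → ℝ) (x : ℕ → V) (t : ℕ) :
    localTime a x (t + 1)
      = fun e => localTime a x t e + if s(x t, x (t + 1)) = e then 1 else 0 := by
  funext e
  unfold localTime
  rw [Finset.range_add_one, Finset.filter_insert]
  split_ifs with h
  · rw [Finset.card_insert_of_notMem (by simp)]
    push_cast
    ring
  · simp

/-- The ERRW weight of the first `t` steps of a path telescopes into a ratio of normalizing
constants. -/
theorem prod_errwStep_mul_Znorm (G : SimpleGraph V) [DecidableRel G.Adj]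
    {a : Sym2 V → ℝ} (ha : ∀ e ∈ G.edgeFinset, 0 < a e) (x : ℕ → V) (t : ℕ)
    (hpath : ∀ k < t, G.Adj (x k) (x (k + 1))) :
    (∏ k ∈ Finset.range t, errwStep G a x k) * Znorm G (x 0) a
      = Znorm G (x t) (localTime a x t) := by
  induction t with
  | zero =>
    have h0 : localTime a x 0 = a := by
      funext e
      simp [localTime]
    simp [h0]
  | succ t ih =>
    have hadj := hpath t t.lt_succ_self
    have hB : ∀ e ∈ G.edgeFinset, 0 < localTime a x t e := fun e he =>
      add_pos_of_pos_of_nonneg (ha e he) (Nat.cast_nonneg _)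
    rw [localTime_succ, Znorm_add_indicator G hadj hB,
      ← ih fun k hk => hpath k (hk.trans t.lt_succ_self), Finset.prod_range_succ]
    simp only [errwStep, if_pos hadj, vw]
    ring

/-- ERRW trajectory probability as a ratio of normalizing constants.
For a path `x_0,…,x_T` in `G` with `x_0 = v0` and `T ≥ 1`, with undirected edge-count
vector `N` and endpoint `x_T`,
`P_errw^{v0,A}(X_0^T = x_0^T) = Z_{x_T, A+N} / Z_{v0, A}`. -/
theorem errw_prob_eq_Z_ratio
    {V : Type*} [Fintype V] [DecidableEq V]
    (G : SimpleGraph V) [DecidableRel G.Adj] (hG : G.Connected)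
    (v0 : V) (a : Sym2 V → ℝ) (ha : ∀ e ∈ G.edgeFinset, 0 < a e)
    (T : ℕ) (hT : 1 ≤ T)
    (x : Fin (T + 1) → V) (hx0 : x 0 = v0)
    (hpath : ∀ t : ℕ, t < T → G.Adj (extendPath v0 x t) (extendPath v0 x (t + 1))) :
    errwProb G v0 a T x
      = Znorm G (x (Fin.last T)) (fun e => a e + (edgeCount v0 x e : ℝ)) / Znorm G v0 a := by
  have hstart : extendPath v0 x 0 = v0 := by simpa [extendPath] using hx0
  have hend : extendPath v0 x T = x (Fin.last T) := by simp [extendPath, Fin.last]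
  have hadj := hpath 0 hT
  rw [hstart] at hadj
  have key := prod_errwStep_mul_Znorm G ha (extendPath v0 x) T hpath
  rw [hstart, hend] at key
  rw [errwProb, if_pos hx0, eq_div_iff (Znorm_pos G hadj ha).ne']
  exact key

end ERRW
end
end
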